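/- Let G be a 2-connected plane graph with outer face cycle C = (v_0,...,v_ℓ), and let P be a prefix (initial segment) of a Hamiltonian path of G. Then the set V(C) ∩ V(P) forms an interval of the cycle C, i.e., a set of consecutive vertices along C. -/

import Mathlib

/-- A crossing-free embedding of a graph `G` in the plane: vertices are mapped to
distinct points, each edge to a simple arc between its endpoints, arcs of an edge and
its reverse agree up to reparametrization, arc interiors avoid vertices, and two arcs
may meet only at common endpoints (unless they are arcs of the same edge). -/
structure PlaneEmbedding {V : Type*} (G : SimpleGraph V) where
  pos : V → ℝ × ℝ
  arc : ∀ {u v : V}, G.Adj u v → ℝ → ℝ × ℝ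
  pos_inj : Function.Injective pos
  arc_contOn : ∀ {u v : V} (h : G.Adj u v), ContinuousOn (arc h) (Set.Icc 0 1)
  arc_injOn : ∀ {u v : V} (h : G.Adj u v), Set.InjOn (arc h) (Set.Icc 0 1)
  arc_zero : ∀ {u v : V} (h : G.Adj u v), arc h 0 = pos u
  arc_one : ∀ {u v : V} (h : G.Adj u v), arc h 1 = pos v
  arc_symm : ∀ {u v : V} (h : G.Adj u v) (t : ℝ), arc h.symm t = arc h (1 - t)
  arc_vertex : ∀ {u v : V} (h : G.Adj u v) (t : ℝ), t ∈ Set.Ioo (0 : ℝ) 1 →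
    arc h t ∉ Set.range pos
  arc_meet : ∀ {u v u' v' : V} (h : G.Adj u v) (h' : G.Adj u' v') (s t : ℝ),
    s ∈ Set.Icc (0 : ℝ) 1 → t ∈ Set.Icc (0 : ℝ) 1 → arc h s = arc h' t →
    s(u, v) = s(u', v') ∨ arc h s ∈ Set.range pos

/-- The point set of the drawing of `G` in the plane. -/
def PlaneEmbedding.drawing {V : Type*} {G : SimpleGraph V} (E : PlaneEmbedding G) :
    Set (ℝ × ℝ) :=
  Set.range E.pos ∪ ⋃ (u : V) (v : V) (h : G.Adj u v), E.arc h '' Set.Icc 0 1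

/-- A face of the embedding: a connected component of the complement of the drawing. -/
def PlaneEmbedding.IsFace {V : Type*} {G : SimpleGraph V} (E : PlaneEmbedding G)
    (F : Set (ℝ × ℝ)) : Prop :=
  ∃ x ∉ E.drawing, F = connectedComponentIn E.drawingᶜ x

/-- The outer face: the unbounded face. -/
def PlaneEmbedding.IsOuterFace {V : Type*} {G : SimpleGraph V} (E : PlaneEmbedding G)
    (F : Set (ℝ × ℝ)) : Prop :=
  E.IsFace F ∧ ¬ Bornology.IsBounded F

/-- The vertices lying on the boundary of the face `F`. -/
def PlaneEmbedding.faceVertexSet {V : Type*} {G : SimpleGraph V} (E : PlaneEmbedding G)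
    (F : Set (ℝ × ℝ)) : Set V :=
  {v | E.pos v ∈ closure F}

/-- `S` is an interval of the cyclic sequence `l`: a set of consecutive entries of `l`
in cyclic order. -/
def IsCycleInterval {V : Type*} (l : List V) (S : Set V) : Prop :=
  ∃ i m : ℕ, S = {x | x ∈ (l.rotate i).take m}

/-- A graph is 2-connected if it has at least 3 vertices and deleting any single
vertex leaves it connected. -/
def TwoConnected {V : Type*} (G : SimpleGraph V) : Prop :=
  3 ≤ Nat.card V ∧ ∀ v : V, (G.induce {u | u ≠ v}).Connected

section K5

/-- A continuous nowhere vanishing function on a contractible space has a logarithm. -/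
lemma exists_log_aux {X : Type*} [TopologicalSpace X] [ContractibleSpace X]
    [LocallyPathConnectedSpace X] (x₀ : X) (g : X → ℂ) (hg : Continuous g) (h0 : ∀ x, g x ≠ 0) :
    ∃ f : X → ℂ, Continuous f ∧ ∀ x, Complex.exp (f x) = g x := by
  obtain ⟨F, ⟨-, hF⟩, -⟩ := Complex.isCoveringMapOn_exp.existsUnique_continuousMap_lifts
    ⟨g, hg⟩ (a₀ := x₀) (e₀ := Complex.log (g x₀)) (Complex.exp_log (h0 x₀)) h0
  exact ⟨F, F.continuous, fun x => congrFun hF x⟩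

lemma log_diff_unique (g₁ g₂ : ℝ → ℂ) (h₁ : Continuous g₁) (h₂ : Continuous g₂) (K : ℂ)
    (h : ∀ t, Complex.exp (g₁ t) = K * Complex.exp (g₂ t)) :
    g₁ 1 - g₁ 0 = g₂ 1 - g₂ 0 := by
  have hu := Complex.isCoveringMapOn_exp.existsUnique_continuousMap_lifts
    (⟨fun t => Complex.exp (g₁ t), by fun_prop⟩ : C(ℝ, ℂ)) (a₀ := (0 : ℝ)) (e₀ := g₁ 0) rfl
    (fun t => Complex.exp_ne_zero _)
  have hK : K = Complex.exp (g₁ 0 - g₂ 0) := by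
    rw [Complex.exp_sub, h 0]; field_simp [Complex.exp_ne_zero]
  have := hu.unique (y₁ := ⟨g₁, h₁⟩) (y₂ := ⟨fun t => g₂ t + (g₁ 0 - g₂ 0), by fun_prop⟩)
    ⟨rfl, rfl⟩ ⟨by simp, by
      funext t
      simp only [Function.comp, ContinuousMap.coe_mk, Complex.exp_add, h t, hK]
      ring⟩
  have h1 : g₁ 1 = g₂ 1 + (g₁ 0 - g₂ 0) := congrArg (fun F : C(ℝ, ℂ) => F 1) this
  rw [h1]; ring

open Classical in
/-- Total change of the logarithm of `c t - z` along the curve `c` on `[0,1]`. -/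
noncomputable def logChange (c : ℝ → ℂ) (z : ℂ) : ℂ :=
  if h : ∃ L : ℝ → ℂ, Continuous L ∧ ∀ t, Complex.exp (L t) = c t - z then
    h.choose 1 - h.choose 0 else 0

lemma logChange_eq (c : ℝ → ℂ) (z : ℂ) (L : ℝ → ℂ) (hL : Continuous L) (K : ℂ) (hK : K ≠ 0)
    (h : ∀ t, Complex.exp (L t) = K * (c t - z)) : logChange c z = L 1 - L 0 := by
  have hex : ∃ L : ℝ → ℂ, Continuous L ∧ ∀ t, Complex.exp (L t) = c t - z := by
    refine ⟨fun t => L t - Complex.log K, by fun_prop, fun t => ?_⟩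
    rw [Complex.exp_sub, h t, Complex.exp_log hK]; field_simp
  rw [logChange, dif_pos hex]
  refine (log_diff_unique L hex.choose hL hex.choose_spec.1 K fun t => ?_).symm
  rw [h t, hex.choose_spec.2 t]

lemma logChange_square (c d : ℝ → ℂ) (hc : Continuous c) (hd : Continuous d)
    (h : ∀ s t, c s ≠ d t) :
    logChange d (c 0) - logChange d (c 1) + logChange c (d 1) - logChange c (d 0) = 0 := by
  obtain ⟨g, hg, hgexp⟩ := exists_log_aux ((0, 0) : ℝ × ℝ) (fun x : ℝ × ℝ => d x.2 - c x.1)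
    (by fun_prop) (fun x => sub_ne_zero.2 (h _ _).symm)
  rw [logChange_eq d (c 0) (fun t => g (0, t)) (by fun_prop) 1 one_ne_zero
      (fun t => by rw [hgexp]; ring),
    logChange_eq d (c 1) (fun t => g (1, t)) (by fun_prop) 1 one_ne_zero
      (fun t => by rw [hgexp]; ring),
    logChange_eq c (d 1) (fun t => g (t, 1)) (by fun_prop) (-1) (by simp)
      (fun t => by rw [hgexp]; ring),
    logChange_eq c (d 0) (fun t => g (t, 0)) (by fun_prop) (-1) (by simp)
      (fun t => by rw [hgexp]; ring)]
  ring

lemma logChange_int (c : ℝ → ℂ) (hc : Continuous c) (z : ℂ) (h : ∀ t, c t ≠ z) (A B : ℂ)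
    (hA : Complex.exp A = c 0 - z) (hB : Complex.exp B = c 1 - z) :
    ∃ n : ℤ, logChange c z = B - A + n * (2 * Real.pi * Complex.I) := by
  obtain ⟨g, hg, hgexp⟩ := exists_log_aux (0 : ℝ) (fun t => c t - z) (by fun_prop)
    (fun x => sub_ne_zero.2 (h _))
  rw [logChange_eq c z g hg 1 one_ne_zero (fun t => by rw [hgexp]; ring)]
  obtain ⟨m, hm⟩ := Complex.exp_eq_exp_iff_exists_int.1 ((hgexp 0).trans hA.symm)
  obtain ⟨n, hn⟩ := Complex.exp_eq_exp_iff_exists_int.1 ((hgexp 1).trans hB.symm)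
  refine ⟨n - m, ?_⟩
  rw [hm, hn]; push_cast; ring

/-- `K₅` cannot be drawn in the plane with independent edges disjoint. -/
lemma no_K5 (P : Fin 5 → ℂ) (γ : Fin 5 → Fin 5 → ℝ → ℂ)
    (hc : ∀ i j, i < j → Continuous (γ i j))
    (h0 : ∀ i j, i < j → γ i j 0 = P i) (h1 : ∀ i j, i < j → γ i j 1 = P j)
    (hd : ∀ u v w x, u < v → w < x → u ≠ w → u ≠ x → v ≠ w → v ≠ x →
      ∀ s t, γ u v s ≠ γ w x t) : False := by
  have hdist : ∀ u v w x, u < v → w < x → u ≠ w → u ≠ x → v ≠ w → v ≠ x →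
      (∀ t, γ w x t ≠ P u) ∧ (∀ t, γ w x t ≠ P v) := by
    intro u v w x huv hwx a b c d
    refine ⟨fun t => ?_, fun t => ?_⟩
    · rw [← h0 u v huv]; exact (hd u v w x huv hwx a b c d 0 t).symm
    · rw [← h1 u v huv]; exact (hd u v w x huv hwx a b c d 1 t).symm
  have hav : ∀ u w x : Fin 5, w < x → u ≠ w → u ≠ x → ∀ t, γ w x t ≠ P u := by
    intro u w x hwx huw hux
    obtain ⟨y, hyu, hyw, hyx⟩ : ∃ y : Fin 5, y ≠ u ∧ y ≠ w ∧ y ≠ x := by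
      clear * - u
      revert u w x; decide
    rcases lt_or_gt_of_ne hyu with h | h
    · exact (hdist y u w x h hwx hyw hyx huw hux).2
    · exact (hdist u y w x h hwx huw hux hyw hyx).1
  have hP : ∀ u w : Fin 5, u ≠ w → P w - P u ≠ 0 := by
    intro u w huw
    obtain ⟨x, hxu, hxw⟩ : ∃ x : Fin 5, x ≠ u ∧ x ≠ w := by
      clear * - u
      revert u w; decide
    rw [sub_ne_zero]
    rcases lt_or_gt_of_ne hxw with h | h
    · rw [← h1 x w h]; exact hav u x w h hxu.symm huw 1
    · rw [← h0 w x h]; exact hav u w x h huw hxu.symm 0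
  let al : Fin 5 → Fin 5 → ℂ := fun v w =>
    if v < w then Complex.log (P w - P v) else Complex.log (P v - P w) + Real.pi * Complex.I
  have hal : ∀ v w, v ≠ w → Complex.exp (al v w) = P w - P v := by
    intro v w hvw
    simp only [al]
    split_ifs
    · exact Complex.exp_log (hP v w hvw)
    · rw [Complex.exp_add, Complex.exp_log (hP w v hvw.symm), Complex.exp_pi_mul_I]; ring
  let sg : Fin 5 → Fin 5 → ℤ := fun v w => if v < w then 1 else -1
  have hsg : ∀ v w, v ≠ w → al w v = al v w + sg v w * (Real.pi * Complex.I) := by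
    intro v w hvw
    rcases lt_or_gt_of_ne hvw with h | h
    · simp [al, sg, h, h.not_gt]
    · simp [al, sg, h, h.not_gt]
  have hn : ∀ u w x : Fin 5, ∃ n : ℤ, w < x → u ≠ w → u ≠ x →
      logChange (γ w x) (P u) = al u x - al u w + n * (2 * Real.pi * Complex.I) := by
    intro u w x
    by_cases h : w < x ∧ u ≠ w ∧ u ≠ x
    · obtain ⟨hwx, huw, hux⟩ := h
      obtain ⟨n, hn⟩ := logChange_int (γ w x) (hc w x hwx) (P u) (hav u w x hwx huw hux)
        (al u w) (al u x) (by rw [hal u w huw, h0 w x hwx]) (by rw [hal u x hux, h1 w x hwx])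
      exact ⟨n, fun _ _ _ => hn⟩
    · exact ⟨0, fun a b c => absurd ⟨a, b, c⟩ h⟩
  choose n hn using hn
  have key : ∀ u v w x, u < v → w < x → u ≠ w → u ≠ x → v ≠ w → v ≠ x →
      2 * (n u w x - n v w x + n x u v - n w u v) +
        (sg u w - sg u x + sg v x - sg v w) = 0 := by
    intro u v w x huv hwx huw hux hvw hvx
    have hs := logChange_square (γ u v) (γ w x) (hc u v huv) (hc w x hwx)
      (hd u v w x huv hwx huw hux hvw hvx)
    rw [h0 u v huv, h1 u v huv, h0 w x hwx, h1 w x hwx, hn u w x hwx huw hux,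
      hn v w x hwx hvw hvx, hn x u v huv hux.symm hvx.symm, hn w u v huv huw.symm hvw.symm,
      hsg u x hux, hsg v x hvx, hsg u w huw, hsg v w hvw] at hs
    have hpi : (Real.pi * Complex.I : ℂ) ≠ 0 := by simp [Real.pi_ne_zero]
    have : ((2 * (n u w x - n v w x + n x u v - n w u v) +
        (sg u w - sg u x + sg v x - sg v w) : ℤ) : ℂ) * (Real.pi * Complex.I) = 0 := by
      push_cast
      linear_combination hs
    exact_mod_cast (mul_eq_zero.1 this).resolve_right hpi
  have e1 := key 0 1 2 3 (by decide) (by decide) (by decide) (by decide) (by decide) (by decide)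
  have e2 := key 0 2 1 3 (by decide) (by decide) (by decide) (by decide) (by decide) (by decide)
  have e3 := key 0 3 1 2 (by decide) (by decide) (by decide) (by decide) (by decide) (by decide)
  have e4 := key 0 1 2 4 (by decide) (by decide) (by decide) (by decide) (by decide) (by decide)
  have e5 := key 0 2 1 4 (by decide) (by decide) (by decide) (by decide) (by decide) (by decide)
  have e6 := key 0 4 1 2 (by decide) (by decide) (by decide) (by decide) (by decide) (by decide)
  have e7 := key 0 1 3 4 (by decide) (by decide) (by decide) (by decide) (by decide) (by decide)
  have e8 := key 0 3 1 4 (by decide) (by decide) (by decide) (by decide) (by decide) (by decide)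
  have e9 := key 0 4 1 3 (by decide) (by decide) (by decide) (by decide) (by decide) (by decide)
  have e10 := key 0 2 3 4 (by decide) (by decide) (by decide) (by decide) (by decide) (by decide)
  have e11 := key 0 3 2 4 (by decide) (by decide) (by decide) (by decide) (by decide) (by decide)
  have e12 := key 0 4 2 3 (by decide) (by decide) (by decide) (by decide) (by decide) (by decide)
  have e13 := key 1 2 3 4 (by decide) (by decide) (by decide) (by decide) (by decide) (by decide)
  have e14 := key 1 3 2 4 (by decide) (by decide) (by decide) (by decide) (by decide) (by decide)
  have e15 := key 1 4 2 3 (by decide) (by decide) (by decide) (by decide) (by decide) (by decide)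
  simp [sg] at e1 e2 e3 e4 e5 e6 e7 e8 e9 e10 e11 e12 e13 e14 e15
  omega

/-- Version of `no_K5` for joined sets in `ℝ × ℝ`. -/
lemma no_K5_joined (P : Fin 5 → ℝ × ℝ) (D : Fin 5 → Fin 5 → Set (ℝ × ℝ))
    (hj : ∀ i j, i < j → JoinedIn (D i j) (P i) (P j))
    (hd : ∀ u v w x, u < v → w < x → u < w → v ≠ w → v ≠ x → Disjoint (D u v) (D w x)) :
    False := by
  classical
  let e := Complex.equivRealProdCLM.symm
  refine no_K5 (fun i => e (P i))
    (fun i j => if h : i < j then fun t => e ((hj i j h).somePath.extend t) else fun _ => 0)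
    ?_ ?_ ?_ ?_
  · intro i j h
    simp only [h, dif_pos]
    exact e.continuous.comp (hj i j h).somePath.continuous_extend
  · intro i j h
    simp [h]
  · intro i j h
    simp [h]
  · intro u v w x huv hwx huw hux hvw hvx s t heq
    simp only [huv, hwx, dif_pos] at heq
    have heq := e.injective heq
    have m : ∀ i j (h : i < j) (t : ℝ), (hj i j h).somePath.extend t ∈ D i j := by
      intro i j h t
      exact (hj i j h).somePath_mem (Set.projIcc 0 1 zero_le_one t)
    have m1 := m u v huv s
    have m2 := m w x hwx t
    rw [heq] at m1
    rcases lt_or_gt_of_ne huw with h | h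
    · exact Set.disjoint_left.1 (hd u v w x huv hwx h hvw hvx) m1 m2
    · exact Set.disjoint_left.1 (hd w x u v hwx huv h hux.symm hvx.symm) m2 m1

end K5

section Emb

lemma fin5_cases (Q : Fin 5 → Fin 5 → Fin 5 → Fin 5 → Prop)
    (h1 : Q 0 1 2 3) (h2 : Q 0 2 1 3) (h3 : Q 0 3 1 2)
    (h4 : Q 0 1 2 4) (h5 : Q 0 2 1 4) (h6 : Q 0 4 1 2)
    (h7 : Q 0 1 3 4) (h8 : Q 0 3 1 4) (h9 : Q 0 4 1 3)
    (h10 : Q 0 2 3 4) (h11 : Q 0 3 2 4) (h12 : Q 0 4 2 3)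
    (h13 : Q 1 2 3 4) (h14 : Q 1 3 2 4) (h15 : Q 1 4 2 3) :
    ∀ u v w x, u < v → w < x → u < w → v ≠ w → v ≠ x → Q u v w x := by
  intro u v w x a b c d e
  fin_cases u <;> fin_cases w <;> first
    | exact absurd c (by decide)
    | (fin_cases v <;> first
        | exact absurd a (by decide)
        | exact absurd rfl d
        | (fin_cases x <;> first
            | assumption
            | exact absurd b (by decide)
            | exact absurd rfl e))

variable {V : Type*} {G : SimpleGraph V}

/-- The part of the drawing spanned by a set of vertices. -/
def PlaneEmbedding.part (E : PlaneEmbedding G) (S : Set V) : Set (ℝ × ℝ) :=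
  E.pos '' S ∪ ⋃ (u : V) (v : V) (h : G.Adj u v) (_ : u ∈ S ∧ v ∈ S), E.arc h '' Set.Icc 0 1

lemma PlaneEmbedding.mem_part (E : PlaneEmbedding G) (S : Set V) (x : ℝ × ℝ) :
    x ∈ E.part S ↔ (∃ v ∈ S, E.pos v = x) ∨
      ∃ (u v : V) (h : G.Adj u v), u ∈ S ∧ v ∈ S ∧ ∃ t ∈ Set.Icc (0 : ℝ) 1, E.arc h t = x := by
  simp only [PlaneEmbedding.part, Set.mem_union, Set.mem_image, Set.mem_iUnion, exists_prop,
    and_assoc]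

lemma PlaneEmbedding.part_isClosed [Finite V] (E : PlaneEmbedding G) (S : Set V) :
    IsClosed (E.part S) := by
  refine IsClosed.union ((Set.toFinite S).image _).isClosed ?_
  refine isClosed_iUnion_of_finite fun u => isClosed_iUnion_of_finite fun v =>
    isClosed_iUnion_of_finite fun h => isClosed_iUnion_of_finite fun _ => ?_
  exact (isCompact_Icc.image_of_continuousOn (E.arc_contOn h)).isClosed

lemma PlaneEmbedding.part_subset (E : PlaneEmbedding G) (S : Set V) :
    E.part S ⊆ E.drawing := by
  intro x hx
  rcases (E.mem_part S x).1 hx with ⟨v, -, rfl⟩ | ⟨u, v, h, -, -, t, ht, rfl⟩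
  · exact Or.inl ⟨v, rfl⟩
  · refine Or.inr ?_
    simp only [Set.mem_iUnion]
    exact ⟨u, v, h, t, ht, rfl⟩

lemma PlaneEmbedding.drawing_isClosed [Finite V] (E : PlaneEmbedding G) :
    IsClosed E.drawing := by
  refine IsClosed.union (Set.finite_range _).isClosed ?_
  refine isClosed_iUnion_of_finite fun u => isClosed_iUnion_of_finite fun v =>
    isClosed_iUnion_of_finite fun h => ?_
  exact (isCompact_Icc.image_of_continuousOn (E.arc_contOn h)).isClosed

lemma PlaneEmbedding.part_mem_range (E : PlaneEmbedding G) (S : Set V) (v : V)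
    (h : E.pos v ∈ E.part S) : v ∈ S := by
  rcases (E.mem_part S _).1 h with ⟨u, hu, h⟩ | ⟨u, w, h, hu, hw, t, ht, hx⟩
  · exact E.pos_inj h ▸ hu
  · rcases eq_or_lt_of_le ht.1 with h0 | h0
    · rw [← h0, E.arc_zero] at hx
      exact E.pos_inj hx ▸ hu
    rcases eq_or_lt_of_le ht.2 with h1 | h1
    · rw [h1, E.arc_one] at hx
      exact E.pos_inj hx ▸ hw
    · exact absurd ⟨v, hx.symm⟩ (E.arc_vertex h t ⟨h0, h1⟩)

lemma PlaneEmbedding.part_disjoint (E : PlaneEmbedding G) {S T : Set V} (hST : Disjoint S T) :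
    Disjoint (E.part S) (E.part T) := by
  rw [Set.disjoint_left]
  intro x hx hy
  have hr : x ∉ Set.range E.pos := by
    rintro ⟨v, rfl⟩
    exact Set.disjoint_left.1 hST (E.part_mem_range S v hx) (E.part_mem_range T v hy)
  rcases (E.mem_part S x).1 hx with ⟨v, -, h⟩ | ⟨u, v, h, hu, hv, t, ht, hx'⟩
  · exact hr ⟨v, h⟩
  rcases (E.mem_part T x).1 hy with ⟨v, -, h⟩ | ⟨u', v', h', hu', hv', t', ht', hy'⟩
  · exact hr ⟨v, h⟩
  rcases E.arc_meet h h' t t' ht ht' (hx'.trans hy'.symm) with h1 | h1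
  · rcases Sym2.eq_iff.1 h1 with ⟨h1, -⟩ | ⟨h1, -⟩
    · exact Set.disjoint_left.1 hST hu (h1 ▸ hu')
    · exact Set.disjoint_left.1 hST hu (h1 ▸ hv')
  · exact hr (hx' ▸ h1)

lemma PlaneEmbedding.part_mono (E : PlaneEmbedding G) {S T : Set V} (h : S ⊆ T) :
    E.part S ⊆ E.part T := by
  intro x hx
  rw [E.mem_part] at hx ⊢
  rcases hx with ⟨v, hv, e⟩ | ⟨u, v, e, hu, hv, r⟩
  · exact Or.inl ⟨v, h hv, e⟩
  · exact Or.inr ⟨u, v, e, h hu, h hv, r⟩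

/-- Consecutive adjacent vertices in a sequence join inside the drawing. -/
lemma PlaneEmbedding.joined_seq (E : PlaneEmbedding G) (f : ℕ → V) (S : Set V) (k : ℕ) :
    ∀ m, k ≤ m → (∀ i, k ≤ i → i < m → G.Adj (f i) (f (i + 1))) →
      (∀ i, k ≤ i → i ≤ m → f i ∈ S) → JoinedIn (E.part S) (E.pos (f k)) (E.pos (f m)) := by
  intro m hkm
  induction m, hkm using Nat.le_induction with
  | base =>
    intro _ h
    exact JoinedIn.refl ((E.mem_part _ _).2 (Or.inl ⟨f k, h k le_rfl le_rfl, rfl⟩))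
  | succ m hkm ih =>
    intro ha hS
    refine (ih (fun i h1 h2 => ha i h1 (by omega)) (fun i h1 h2 => hS i h1 (by omega))).trans ?_
    have hadj := ha m hkm (by omega)
    refine JoinedIn.ofLine (E.arc_contOn hadj) (E.arc_zero hadj) (E.arc_one hadj) ?_
    rintro _ ⟨t, ht, rfl⟩
    exact (E.mem_part _ _).2 (Or.inr ⟨_, _, hadj, hS _ hkm (by omega), hS _ (by omega) le_rfl,
      t, ht, rfl⟩)

lemma joined_leg {F K : Set (ℝ × ℝ)} (hF : IsPathConnected F) (hK : IsClosed K)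
    (hFK : Disjoint F K) {p q : ℝ × ℝ} (hp : p ∈ F) (hq : q ∈ closure F) (hqK : q ∉ K) :
    JoinedIn Kᶜ p q := by
  obtain ⟨ε, hε, hb⟩ := Metric.isOpen_iff.1 hK.isOpen_compl q hqK
  obtain ⟨y, hyF, hy⟩ := Metric.mem_closure_iff.1 hq ε hε
  refine ((hF.joinedIn p hp y hyF).mono hFK.subset_compl_right).trans ?_
  refine JoinedIn.mono ?_ hb
  refine ((convex_ball q ε).isPathConnected ⟨q, Metric.mem_ball_self hε⟩).joinedIn y ?_ q ?_
  · rwa [Metric.mem_ball, dist_comm]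
  · exact Metric.mem_ball_self hε

lemma PlaneEmbedding.no_cross [Finite V] (E : PlaneEmbedding G) (F : Set (ℝ × ℝ))
    (hF : E.IsFace F) (a b c d : V)
    (ha : a ∈ E.faceVertexSet F) (hb : b ∈ E.faceVertexSet F) (hc : c ∈ E.faceVertexSet F)
    (hd : d ∈ E.faceVertexSet F) (Sab Sbc Scd Sad A B : Set V)
    (jab : JoinedIn (E.part Sab) (E.pos a) (E.pos b))
    (jbc : JoinedIn (E.part Sbc) (E.pos b) (E.pos c))
    (jcd : JoinedIn (E.part Scd) (E.pos c) (E.pos d))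
    (jad : JoinedIn (E.part Sad) (E.pos a) (E.pos d))
    (jA : JoinedIn (E.part A) (E.pos a) (E.pos c))
    (jB : JoinedIn (E.part B) (E.pos b) (E.pos d))
    (h1 : Disjoint Sab Scd) (h2 : Disjoint Sad Sbc) (h3 : Disjoint A B) : False := by
  obtain ⟨p, hp, rfl⟩ := hF
  set F := connectedComponentIn E.drawingᶜ p with hFdef
  have hpF : p ∈ F := mem_connectedComponentIn hp
  have hFo : IsOpen F := E.drawing_isClosed.isOpen_compl.connectedComponentIn
  have hFp : IsPathConnected F := hFo.isConnected_iff_isPathConnected.1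
    (isConnected_connectedComponentIn_iff.2 hp)
  have hFd : Disjoint F E.drawing :=
    Set.disjoint_left.2 fun x hx => connectedComponentIn_subset _ _ hx
  have h1' := Set.disjoint_left.1 (E.part_disjoint h1)
  have h2' := Set.disjoint_left.1 (E.part_disjoint h2)
  have h3' := Set.disjoint_left.1 (E.part_disjoint h3)
  have leg : ∀ (v : V) (X Y Z : Set V), v ∈ E.faceVertexSet F → E.pos v ∉ E.part X →
      E.pos v ∉ E.part Y → E.pos v ∉ E.part Z →
      JoinedIn (E.part X ∪ E.part Y ∪ E.part Z)ᶜ (E.pos v) p := by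
    intro v X Y Z hv hX hY hZ
    refine (joined_leg hFp (((E.part_isClosed X).union (E.part_isClosed Y)).union
      (E.part_isClosed Z)) (hFd.mono_right ?_) hpF hv ?_).symm
    · exact Set.union_subset (Set.union_subset (E.part_subset X) (E.part_subset Y))
        (E.part_subset Z)
    · rintro ((h | h) | h)
      exacts [hX h, hY h, hZ h]
  have la := leg a Sbc Scd B ha (h2' jad.source_mem) (h1' jab.source_mem) (h3' jA.source_mem)
  have lb := leg b Scd Sad A hb (h1' jab.target_mem) (fun h => h2' h jbc.source_mem)
    (fun h => h3' h jB.source_mem)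
  have lc := leg c Sab Sad B hc (fun h => h1' h jcd.source_mem) (fun h => h2' h jbc.target_mem)
    (h3' jA.target_mem)
  have ld := leg d Sab Sbc A hd (fun h => h1' h jcd.target_mem) (h2' jad.target_mem)
    (fun h => h3' h jB.target_mem)
  let D : Fin 5 → Fin 5 → Set (ℝ × ℝ) := ![
    ![∅, E.part Sab, E.part A, E.part Sad, (E.part Sbc ∪ E.part Scd ∪ E.part B)ᶜ],
    ![∅, ∅, E.part Sbc, E.part B, (E.part Scd ∪ E.part Sad ∪ E.part A)ᶜ],
    ![∅, ∅, ∅, E.part Scd, (E.part Sab ∪ E.part Sad ∪ E.part B)ᶜ],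
    ![∅, ∅, ∅, ∅, (E.part Sab ∪ E.part Sbc ∪ E.part A)ᶜ],
    ![∅, ∅, ∅, ∅, ∅]]
  refine no_K5_joined ![E.pos a, E.pos b, E.pos c, E.pos d, p] D ?_ ?_
  · intro i j hij
    fin_cases i <;> fin_cases j <;> first
      | exact absurd hij (by decide)
      | assumption
  · have sub : ∀ {X Y : Set (ℝ × ℝ)}, X ⊆ Y → Disjoint X Yᶜ := fun h =>
      Set.disjoint_compl_right_iff_subset.2 h
    apply fin5_cases (fun u v w x => Disjoint (D u v) (D w x))
    · exact E.part_disjoint h1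
    · exact E.part_disjoint h3
    · exact E.part_disjoint h2
    · exact sub (fun x hx => Or.inl (Or.inl hx))
    · exact sub (fun x hx => Or.inr hx)
    · exact (sub (fun x hx => Or.inl (Or.inl hx))).symm
    · exact sub (fun x hx => Or.inl (Or.inl hx))
    · exact sub (fun x hx => Or.inl (Or.inr hx))
    · exact (sub (fun x hx => Or.inr hx)).symm
    · exact sub (fun x hx => Or.inr hx)
    · exact sub (fun x hx => Or.inl (Or.inr hx))
    · exact (sub (fun x hx => Or.inl (Or.inr hx))).symm
    · exact sub (fun x hx => Or.inl (Or.inr hx))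
    · exact sub (fun x hx => Or.inr hx)
    · exact (sub (fun x hx => Or.inl (Or.inl hx))).symm

/-- A subset of a list not containing an alternating quadruple is a cyclic interval. -/
lemma isCycleInterval_of_no_alternating (n : ℕ) (l : List V) (hn : l.length = n)
    (hnd : l.Nodup) (S : Set V) (hS : ∀ x ∈ S, x ∈ l)
    (h1 : ∀ i₁ i₂ i₃ i₄ (h₁ : i₁ < i₂) (h₂ : i₂ < i₃) (h₃ : i₃ < i₄) (h₄ : i₄ < l.length),
      l[i₁] ∈ S → l[i₂] ∉ S → l[i₃] ∈ S → l[i₄] ∉ S → False)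
    (h2 : ∀ i₁ i₂ i₃ i₄ (h₁ : i₁ < i₂) (h₂ : i₂ < i₃) (h₃ : i₃ < i₄) (h₄ : i₄ < l.length),
      l[i₁] ∉ S → l[i₂] ∈ S → l[i₃] ∉ S → l[i₄] ∈ S → False) :
    IsCycleInterval l S := by
  classical
  subst hn
  have mem : ∀ i m, m ≤ l.length → ∀ k (hk : k < l.length), l[k] ∈ (l.rotate i).take m ↔
      ∃ r < m, (r + i) % l.length = k := by
    intro i m hm k hk
    rw [List.mem_take_iff_getElem]
    constructor
    · rintro ⟨r, hr, h⟩
      rw [List.getElem_rotate] at h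
      exact ⟨r, by omega, hnd.getElem_inj_iff.1 h⟩
    · rintro ⟨r, hr, h⟩
      refine ⟨r, by rw [List.length_rotate]; omega, ?_⟩
      rw [List.getElem_rotate]
      exact hnd.getElem_inj_iff.2 h
  have ext : ∀ i m, m ≤ l.length → (∀ k (hk : k < l.length), l[k] ∈ S ↔
      ∃ r < m, (r + i) % l.length = k) → IsCycleInterval l S := by
    intro i m hm h
    refine ⟨i, m, ?_⟩
    ext x
    by_cases hx : x ∈ l
    · obtain ⟨k, hk, rfl⟩ := List.getElem_of_mem hx
      rw [h k hk, Set.mem_setOf_eq, mem i m hm k hk]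
    · constructor
      · intro h; exact absurd (hS x h) hx
      · intro h; exact absurd (List.mem_rotate.1 (List.mem_of_mem_take h)) hx
  by_cases hT : ∃ k, ∃ hk : k < l.length, l[k] ∈ S
  swap
  · refine ext 0 0 (by omega) fun k hk => ?_
    constructor
    · intro h; exact absurd ⟨k, hk, h⟩ hT
    · rintro ⟨r, hr, -⟩; omega
  by_cases hFa : ∃ k, ∃ hk : k < l.length, l[k] ∉ S
  swap
  · push Not at hFa
    refine ext 0 l.length le_rfl fun k hk => ?_
    exact ⟨fun _ => ⟨k, hk, Nat.mod_eq_of_lt hk⟩, fun _ => hFa k hk⟩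
  have hpos : 0 < l.length := by obtain ⟨k, hk, -⟩ := hT; omega
  -- first and last element satisfying a predicate
  have fl : ∀ Q : ℕ → Prop, (∃ k < l.length, Q k) → ∃ s e, s ≤ e ∧ e < l.length ∧ Q s ∧ Q e ∧
      ∀ k < l.length, Q k → s ≤ k ∧ k ≤ e := by
    intro Q hQ
    have hs := Nat.find_spec hQ
    obtain ⟨k0, hk0, hQ0⟩ := hQ
    have he := Nat.findGreatest_spec (P := fun k => k < l.length ∧ Q k) hk0.le ⟨hk0, hQ0⟩
    refine ⟨_, _, ?_, he.1, hs.2, he.2, ?_⟩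
    · exact Nat.find_min' _ he
    · intro k hk hq
      exact ⟨Nat.find_min' _ ⟨hk, hq⟩, Nat.le_findGreatest hk.le ⟨hk, hq⟩⟩
  by_cases h0 : l[0] ∈ S
  · obtain ⟨s, e, hse, he, ⟨hs', hs⟩, ⟨he', heS⟩, hb⟩ :=
      fl (fun k => ∃ hk : k < l.length, l[k] ∉ S) (by
        obtain ⟨k, hk, h⟩ := hFa; exact ⟨k, hk, hk, h⟩)
    have hs0 : s ≠ 0 := by rintro rfl; exact hs h0
    refine ext (e + 1) (l.length - (e + 1) + s) (by omega) fun k hk => ?_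
    have hk' : l[k] ∈ S ↔ k < s ∨ e < k := by
      constructor
      · intro h
        by_contra hcon
        have hks : k ≠ s := by rintro rfl; exact hs h
        have hke : k ≠ e := by rintro rfl; exact heS h
        exact h1 0 s k e (by omega) (by omega) (by omega) he h0 hs h heS
      · intro h
        by_contra hcon
        have := hb k hk ⟨hk, hcon⟩
        omega
    rw [hk']
    constructor
    · rintro (h | h)
      · refine ⟨l.length - (e + 1) + k, by omega, ?_⟩
        rw [show l.length - (e + 1) + k + (e + 1) = k + l.length by omega, Nat.add_mod_right,
          Nat.mod_eq_of_lt hk]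
      · refine ⟨k - (e + 1), by omega, ?_⟩
        rw [show k - (e + 1) + (e + 1) = k by omega, Nat.mod_eq_of_lt hk]
    · rintro ⟨r, hr, h⟩
      by_cases hlt : r + (e + 1) < l.length
      · rw [Nat.mod_eq_of_lt hlt] at h; omega
      · rw [Nat.mod_eq_sub_mod (by omega), Nat.mod_eq_of_lt (by omega)] at h; omega
  · obtain ⟨s, e, hse, he, ⟨hs', hs⟩, ⟨he', heS⟩, hb⟩ :=
      fl (fun k => ∃ hk : k < l.length, l[k] ∈ S) (by
        obtain ⟨k, hk, h⟩ := hT; exact ⟨k, hk, hk, h⟩)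
    have hs0 : s ≠ 0 := by rintro rfl; exact h0 hs
    refine ext s (e + 1 - s) (by omega) fun k hk => ?_
    have hk' : l[k] ∈ S ↔ s ≤ k ∧ k ≤ e := by
      constructor
      · intro h
        exact hb k hk ⟨hk, h⟩
      · intro h
        by_contra hcon
        have hks : k ≠ s := by rintro rfl; exact hcon hs
        have hke : k ≠ e := by rintro rfl; exact hcon heS
        exact h2 0 s k e (by omega) (by omega) (by omega) he h0 hs hcon heS
    rw [hk']
    constructor
    · rintro ⟨h, h'⟩
      refine ⟨k - s, by omega, ?_⟩
      rw [Nat.sub_add_cancel h, Nat.mod_eq_of_lt hk]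
    · rintro ⟨r, hr, h⟩
      rw [Nat.mod_eq_of_lt (by omega)] at h; omega

end Emb

/-- Let `G` be a 2-connected plane graph whose outer face is bounded by the cycle `c`,
and let `P` be a prefix of a Hamiltonian path of `G`.  Then the vertices of the outer
face cycle visited by the prefix form an interval of the cycle. -/
theorem outerFace_prefix_interval {V : Type*} [Fintype V] [DecidableEq V] (G : SimpleGraph V)
    (hG : TwoConnected G) (E : PlaneEmbedding G) (F : Set (ℝ × ℝ))
    (hF : E.IsOuterFace F) (w : V) (c : G.Walk w w) (hc : c.IsCycle)
    (hboundary : {x | x ∈ c.support} = E.faceVertexSet F)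
    (a b : V) (p : G.Walk a b) (hp : p.IsHamiltonian) (j : ℕ) :
    IsCycleInterval c.support.tail
      (E.faceVertexSet F ∩ {x | x ∈ p.support.take j}) := by
  classical
  have hvF : ∀ k, c.getVert k ∈ E.faceVertexSet F := by
    intro k
    rw [← hboundary]
    exact c.getVert_mem_support k
  have hlen : c.support.tail.length = c.length := by simp
  have hget : ∀ k (hk : k < c.support.tail.length), c.support.tail[k] = c.getVert (k + 1) := by
    intro k hk
    rw [List.getElem_tail, c.getVert_eq_support_getElem (by omega)]
  have hinj := hc.getVert_injOn
  have hinjp := hp.isPath.getVert_injOn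
  -- the two sides of the Hamiltonian path
  let A : Set V := {x | ∃ i, i < j ∧ i ≤ p.length ∧ p.getVert i = x}
  let B : Set V := {x | ∃ i, j ≤ i ∧ i ≤ p.length ∧ p.getVert i = x}
  have hAB : Disjoint A B := by
    rw [Set.disjoint_left]
    rintro x ⟨i, hi, hi', rfl⟩ ⟨k, hk, hk', h⟩
    have := hinjp hk' hi' h
    omega
  have hAmem : ∀ x, x ∈ p.support.take j ↔ x ∈ A := by
    intro x
    rw [List.mem_take_iff_getElem]
    constructor
    · rintro ⟨i, hi, rfl⟩
      have : i < j ∧ i ≤ p.length := by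
        have := p.length_support; omega
      exact ⟨i, this.1, this.2, p.getVert_eq_support_getElem this.2⟩
    · rintro ⟨i, hi, hi', rfl⟩
      have := p.length_support
      exact ⟨i, by omega, (p.getVert_eq_support_getElem hi').symm⟩
  have hBmem : ∀ x, x ∉ A → x ∈ B := by
    intro x hx
    obtain ⟨i, hi, hi'⟩ := SimpleGraph.Walk.mem_support_iff_exists_getVert.1 (hp.mem_support x)
    by_cases hij : i < j
    · exact absurd ⟨i, hij, hi', hi⟩ hx
    · exact ⟨i, by omega, hi', hi⟩
  have jA : ∀ x ∈ A, ∀ y ∈ A, JoinedIn (E.part A) (E.pos x) (E.pos y) := by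
    have : ∀ i k, i ≤ k → k < j → k ≤ p.length →
        JoinedIn (E.part A) (E.pos (p.getVert i)) (E.pos (p.getVert k)) := by
      intro i k hik hkj hk
      refine E.joined_seq p.getVert A i k hik ?_ ?_
      · intro r _ hr; exact p.adj_getVert_succ (by omega)
      · intro r _ hr; exact ⟨r, by omega, by omega, rfl⟩
    rintro _ ⟨i, hi, hi', rfl⟩ _ ⟨k, hk, hk', rfl⟩
    rcases le_total i k with h | h
    · exact this i k h hk hk'
    · exact (this k i h hi hi').symm
  have jB : ∀ x ∈ B, ∀ y ∈ B, JoinedIn (E.part B) (E.pos x) (E.pos y) := by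
    have : ∀ i k, i ≤ k → j ≤ i → k ≤ p.length →
        JoinedIn (E.part B) (E.pos (p.getVert i)) (E.pos (p.getVert k)) := by
      intro i k hik hkj hk
      refine E.joined_seq p.getVert B i k hik ?_ ?_
      · intro r _ hr; exact p.adj_getVert_succ (by omega)
      · intro r _ hr; exact ⟨r, by omega, by omega, rfl⟩
    rintro _ ⟨i, hi, hi', rfl⟩ _ ⟨k, hk, hk', rfl⟩
    rcases le_total i k with h | h
    · exact this i k h hi hk'
    · exact (this k i h hk hi').symm
  -- the main contradiction
  have main : ∀ (X Y : Set V), Disjoint X Y →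
      (∀ x ∈ X, ∀ y ∈ X, JoinedIn (E.part X) (E.pos x) (E.pos y)) →
      (∀ x ∈ Y, ∀ y ∈ Y, JoinedIn (E.part Y) (E.pos x) (E.pos y)) →
      ∀ i₁ i₂ i₃ i₄, 1 ≤ i₁ → i₁ < i₂ → i₂ < i₃ → i₃ < i₄ → i₄ ≤ c.length →
      c.getVert i₁ ∈ X → c.getVert i₂ ∈ Y → c.getVert i₃ ∈ X → c.getVert i₄ ∈ Y → False := by
    intro X Y hXY jX jY i₁ i₂ i₃ i₄ h0 h1 h2 h3 h4 m1 m2 m3 m4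
    let S : Set ℕ → Set V := fun I => {x | ∃ i ∈ I, 1 ≤ i ∧ i ≤ c.length ∧ c.getVert i = x}
    have hS : ∀ I J : Set ℕ, Disjoint I J → Disjoint (S I) (S J) := by
      intro I J hIJ
      rw [Set.disjoint_left]
      rintro x ⟨i, hi, hi1, hi2, rfl⟩ ⟨k, hk, hk1, hk2, h⟩
      have := hinj ⟨hk1, hk2⟩ ⟨hi1, hi2⟩ h
      exact Set.disjoint_left.1 hIJ hi (this ▸ hk)
    have jS : ∀ (I : Set ℕ) i k, 1 ≤ i → i ≤ k → k ≤ c.length → Set.Icc i k ⊆ I →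
        JoinedIn (E.part (S I)) (E.pos (c.getVert i)) (E.pos (c.getVert k)) := by
      intro I i k hi hik hk hI
      refine E.joined_seq c.getVert (S I) i k hik ?_ ?_
      · intro r _ hr; exact c.adj_getVert_succ (by omega)
      · intro r hr hr'; exact ⟨r, hI ⟨hr, hr'⟩, by omega, by omega, rfl⟩
    have jad : JoinedIn (E.part (S {i | i ≤ i₁ ∨ i₄ ≤ i})) (E.pos (c.getVert i₁))
        (E.pos (c.getVert i₄)) := by
      have e1 : JoinedIn (E.part (S {i | i ≤ i₁ ∨ i₄ ≤ i})) (E.pos (c.getVert 0))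
          (E.pos (c.getVert i₁)) := by
        refine E.joined_seq c.getVert _ 0 i₁ (by omega) ?_ ?_
        · intro r _ hr; exact c.adj_getVert_succ (by omega)
        · intro r hr hr'
          rcases Nat.eq_zero_or_pos r with rfl | hpos
          · refine ⟨c.length, Or.inr h4, by omega, le_rfl, ?_⟩
            rw [c.getVert_length, c.getVert_zero]
          · exact ⟨r, Or.inl hr', by omega, by omega, rfl⟩
      have e2 := jS {i | i ≤ i₁ ∨ i₄ ≤ i} i₄ c.length (by omega) h4 le_rfl
        (fun r hr => Or.inr hr.1)
      rw [c.getVert_length] at e2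
      rw [c.getVert_zero] at e1
      exact (e2.trans e1).symm
    refine E.no_cross F hF.1 _ _ _ _ (hvF i₁) (hvF i₂) (hvF i₃) (hvF i₄)
      (S (Set.Icc i₁ i₂)) (S (Set.Icc i₂ i₃)) (S (Set.Icc i₃ i₄)) _ X Y
      (jS _ i₁ i₂ h0 h1.le (by omega) le_rfl) (jS _ i₂ i₃ (by omega) h2.le (by omega) le_rfl)
      (jS _ i₃ i₄ (by omega) h3.le (by omega) le_rfl) jad (jX _ m1 _ m3) (jY _ m2 _ m4)
      (hS _ _ ?_) (hS _ _ ?_) hXY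
    · rw [Set.disjoint_left]
      rintro r ⟨_, hr⟩ ⟨hr', _⟩
      omega
    · rw [Set.disjoint_left]
      rintro r hr ⟨hr1, hr2⟩
      simp only [Set.mem_setOf_eq] at hr
      omega
  have hmemS : ∀ k (hk : k < c.support.tail.length), c.support.tail[k] ∈
      (E.faceVertexSet F ∩ {x | x ∈ p.support.take j}) ↔ c.getVert (k + 1) ∈ A := by
    intro k hk
    rw [hget k hk, Set.mem_inter_iff, Set.mem_setOf_eq, hAmem]
    exact and_iff_right (hvF _)
  refine isCycleInterval_of_no_alternating _ _ rfl hc.support_nodup _ ?_ ?_ ?_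
  · rintro x ⟨hx, -⟩
    rw [← hboundary] at hx
    have hx : x ∈ c.support := hx
    rw [SimpleGraph.Walk.mem_support_iff] at hx
    rcases hx with rfl | hx
    · exact c.end_mem_tail_support hc.not_nil
    · exact hx
  · intro i₁ i₂ i₃ i₄ h₁ h₂ h₃ h₄ m1 m2 m3 m4
    rw [hmemS] at m1 m2 m3 m4
    exact main A B hAB jA jB _ _ _ _ (by omega) (Nat.succ_lt_succ h₁) (Nat.succ_lt_succ h₂)
      (Nat.succ_lt_succ h₃) (by omega) m1 (hBmem _ m2) m3 (hBmem _ m4)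
  · intro i₁ i₂ i₃ i₄ h₁ h₂ h₃ h₄ m1 m2 m3 m4
    rw [hmemS] at m1 m2 m3 m4
    exact main B A hAB.symm jB jA _ _ _ _ (by omega) (Nat.succ_lt_succ h₁) (Nat.succ_lt_succ h₂)
      (Nat.succ_lt_succ h₃) (by omega) (hBmem _ m1) m2 (hBmem _ m3) m4
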